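/- For all θ with 0 < θ ≤ π/4, the function f(β) = (cos(θ − β) − sin β)/(cos(θ/2 − β) − sin(3θ/2 − β)) is decreasing in β for θ/2 ≤ β ≤ θ, so it is maximized at β = θ/2 where it equals 1/(cos(θ/2) − sin(θ/2)). -/

import Mathlib

open Real

theorem stmt3 (θ : ℝ) (hθ0 : 0 < θ) (hθ : θ ≤ π / 4) :
    AntitoneOn (fun β : ℝ =>
        (Real.cos (θ - β) - Real.sin β) /
          (Real.cos (θ / 2 - β) - Real.sin (3 * θ / 2 - β)))
      (Set.Icc (θ / 2) θ) ∧
    (∀ β ∈ Set.Icc (θ / 2) θ,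
      (Real.cos (θ - β) - Real.sin β) /
          (Real.cos (θ / 2 - β) - Real.sin (3 * θ / 2 - β)) ≤
        1 / (Real.cos (θ / 2) - Real.sin (θ / 2))) ∧
    (Real.cos (θ - θ / 2) - Real.sin (θ / 2)) /
        (Real.cos (θ / 2 - θ / 2) - Real.sin (3 * θ / 2 - θ / 2)) =
      1 / (Real.cos (θ / 2) - Real.sin (θ / 2)) := by
  have hπ := Real.pi_pos
  have hA : 0 ≤ cos θ := cos_nonneg_of_neg_pi_div_two_le_of_le (by linarith) (by linarith)
  have hB : 0 ≤ 1 - sin θ := by linarith [sin_le_one θ]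
  have hC : 0 ≤ cos (θ / 2) - sin (3 * θ / 2) := by
    rw [← sin_pi_div_two_sub (θ / 2), sub_nonneg]
    exact sin_le_sin_of_le_of_le_pi_div_two (by linarith) (by linarith) (by linarith)
  have hE : 0 < sin (θ / 2) + cos (3 * θ / 2) :=
    add_pos (sin_pos_of_pos_of_lt_pi (by linarith) (by linarith))
      (cos_pos_of_mem_Ioo ⟨by linarith, by linarith⟩)
  have hD : ∀ β ∈ Set.Icc (θ / 2) θ, 0 < cos (θ / 2 - β) - sin (3 * θ / 2 - β) := by
    rintro β ⟨h₁, h₂⟩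
    have hs : 0 < sin β := sin_pos_of_pos_of_lt_pi (by linarith) (by linarith)
    have hc : 0 ≤ cos β := cos_nonneg_of_neg_pi_div_two_le_of_le (by linarith) (by linarith)
    rw [cos_sub, sin_sub]
    linarith [mul_nonneg hC hc, mul_pos hE hs]
  have hanti : AntitoneOn (fun β : ℝ =>
      (cos (θ - β) - sin β) / (cos (θ / 2 - β) - sin (3 * θ / 2 - β)))
      (Set.Icc (θ / 2) θ) := by
    intro x hx y hy hxy
    have hs : 0 ≤ sin (y - x) :=
      sin_nonneg_of_nonneg_of_le_pi (by linarith) (by linarith [hx.1, hy.2])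
    have key : 0 ≤ (cos θ * (sin (θ / 2) + cos (3 * θ / 2)) +
        (1 - sin θ) * (cos (θ / 2) - sin (3 * θ / 2))) * sin (y - x) :=
      mul_nonneg (add_nonneg (mul_nonneg hA hE.le) (mul_nonneg hB hC)) hs
    refine (div_le_div_iff₀ (hD y hy) (hD x hx)).2 ?_
    simp only [cos_sub, sin_sub] at key ⊢
    linear_combination key
  have hval : (cos (θ - θ / 2) - sin (θ / 2)) /
      (cos (θ / 2 - θ / 2) - sin (3 * θ / 2 - θ / 2)) =
      1 / (cos (θ / 2) - sin (θ / 2)) := by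
    have hsq : cos (θ / 2 - θ / 2) - sin (3 * θ / 2 - θ / 2) =
        (cos (θ / 2) - sin (θ / 2)) ^ 2 := by
      rw [sub_self, cos_zero, show 3 * θ / 2 - θ / 2 = 2 * (θ / 2) by ring, sin_two_mul]
      linear_combination -sin_sq_add_cos_sq (θ / 2)
    have hne : cos (θ / 2) - sin (θ / 2) ≠ 0 := by
      intro h
      have := hD (θ / 2) ⟨le_rfl, by linarith⟩
      rw [hsq, h] at this
      norm_num at this
    rw [hsq, sub_half]
    field_simp
  refine ⟨hanti, fun β hβ => ?_, hval⟩
  rw [← hval]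
  exact hanti ⟨le_rfl, by linarith⟩ hβ hβ.1
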